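/- arXiv:2006.12182 — 5 statements merged into one kernel-verified Lean document; each statement's English description precedes it below -/
import Mathlib

section
/- Let $K$ be a field, $H$ a group, $\sigma$ a finite index type, and $\chi_j : H \to K^{\times}$ a character for each $j \in \sigma$; call an index $j$ moving if there exists $h \in H$ with $\chi_j(h) \neq 1$. Let $e : \sigma \to \mathbb{N}$ be a finitely supported exponent vector such that the monomial $x^e = \prod_j x_j^{e_j}$ is invariant, i.e. $\prod_j \chi_j(h)^{e_j} = 1$ for every $h \in H$. Then for every moving index $k$, the formal partial derivative $\partial_k(x^e)$ lies in the ideal of the polynomial ring $K[x_j : j \in \sigma]$ generated by the moving variables $\{x_m : m \text{ moving}\}$. -/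
/-- Let `K` be a field, `H` a group, `σ` a finite index type, and
`χ j : H →* Kˣ` a character for each `j`; an index `j` is *moving* if there is `h : H`
with `χ j h ≠ 1`.  If `e : σ →₀ ℕ` is an exponent vector whose monomial `x^e` is
invariant, i.e. `∏ j, χ j h ^ e j = 1` for every `h`, then for every moving index `k`
the formal partial derivative `∂ₖ (x^e)` lies in the ideal of `K[xⱼ : j ∈ σ]` generated
by the moving variables. -/
theorem monomial_pderiv_mem_moving_ideal
    {K H σ : Type*} [Field K] [Group H] [Fintype σ]
    (χ : σ → H →* Kˣ) (e : σ →₀ ℕ)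
    (hinv : ∀ h : H, ∏ j : σ, ((χ j h : K)) ^ (e j) = 1)
    (k : σ) (hk : ∃ h : H, χ k h ≠ 1) :
    MvPolynomial.pderiv k (MvPolynomial.monomial e (1 : K)) ∈
      Ideal.span (MvPolynomial.X '' {m : σ | ∃ h : H, χ m h ≠ 1} :
        Set (MvPolynomial σ K)) := by
  classical
  rw [MvPolynomial.pderiv_monomial, MvPolynomial.mem_ideal_span_X_image]
  intro m hm
  rw [MvPolynomial.mem_support_iff, MvPolynomial.coeff_monomial] at hm
  obtain ⟨rfl, hne⟩ := ite_ne_right_iff.mp hm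
  have hek : e k ≠ 0 := fun h0 => hne (by simp [h0])
  by_contra! hcon
  have hk1 : e k = 1 := by
    have := hcon k hk
    simp only [Finsupp.tsub_apply, Finsupp.single_eq_same] at this
    omega
  obtain ⟨h, hh⟩ := hk
  refine hh (Units.ext ?_)
  have hprod : ∏ j : σ, ((χ j h : K)) ^ (e j) = (χ k h : K) ^ (e k) := by
    refine Fintype.prod_eq_single k fun j hjk => ?_
    by_cases hj : χ j h = 1
    · simp [hj]
    · have := hcon j ⟨h, hj⟩
      rw [Finsupp.tsub_apply, Finsupp.single_eq_of_ne hjk, tsub_zero] at this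
      rw [this, pow_zero]
  rw [hinv h, hk1, pow_one] at hprod
  simpa using hprod.symm
end

section
/- Let $K$ be a field, $H$ a group, $\sigma$ a finite index type, and $\chi_j : H \to K^{\times}$ a character for each $j \in \sigma$; call an index $j$ moving if there exists $h \in H$ with $\chi_j(h) \neq 1$. Let $f \in K[x_j : j \in \sigma]$ be $H$-invariant, i.e. $T_h(f) = f$ for all $h \in H$, where $T_h$ is the $K$-algebra endomorphism with $T_h(x_j) = \chi_j(h)\, x_j$. Then for every moving index $k$, the partial derivative $\partial_k f$ lies in the ideal generated by the moving variables $\{x_m : m \text{ moving}\}$. -/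
/-- The diagonal substitution `xⱼ ↦ cⱼ xⱼ` scales the coefficient at `x ^ m` by `∏ⱼ cⱼ ^ mⱼ`. -/
theorem MvPolynomial.coeff_aeval_smul_X {R σ : Type*} [CommSemiring R] (c : σ → R)
    (f : MvPolynomial σ R) (m : σ →₀ ℕ) :
    coeff m (aeval (fun j => c j • (X j : MvPolynomial σ R)) f) =
      (m.prod fun j n => c j ^ n) * coeff m f := by
  classical
  induction f using MvPolynomial.induction_on' with
  | add p q hp hq => rw [map_add, coeff_add, hp, hq, coeff_add, mul_add]
  | monomial s a =>
    have key : aeval (fun j => c j • (X j : MvPolynomial σ R)) (monomial s a) =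
        monomial s ((s.prod fun j n => c j ^ n) * a) := by
      rw [aeval_monomial, monomial_eq, algebraMap_eq, C_mul]
      simp only [Finsupp.prod, smul_eq_C_mul, mul_pow, Finset.prod_mul_distrib, map_prod, map_pow]
      ring
    rw [key, coeff_monomial, coeff_monomial]
    split_ifs with h
    · rw [h]
    · rw [mul_zero]


/-- Let `K` be a field, `H` a group, `σ` a finite index type, with
characters `χ j : H →* Kˣ`; an index `j` is *moving* if some `h : H` has `χ j h ≠ 1`.
The group acts diagonally on `K[xⱼ : j ∈ σ]` via the `K`-algebra endomorphisms `T h`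
with `T h (xⱼ) = χ j h • xⱼ`.  If `f` is `H`-invariant (`T h f = f` for all `h`), then
for every moving index `k` the partial derivative `∂ₖ f` lies in the ideal generated by
the moving variables. -/
theorem pderiv_invariant_mem_moving_ideal
    {K H σ : Type*} [Field K] [Group H] [Fintype σ]
    (χ : σ → H →* Kˣ) (f : MvPolynomial σ K)
    (hf : ∀ h : H,
      MvPolynomial.aeval
        (fun j => ((χ j h : K)) • (MvPolynomial.X j : MvPolynomial σ K)) f = f)
    (k : σ) (hk : ∃ h : H, χ k h ≠ 1) :
    MvPolynomial.pderiv k f ∈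
      Ideal.span (MvPolynomial.X '' {m : σ | ∃ h : H, χ m h ≠ 1} :
        Set (MvPolynomial σ K)) := by
  obtain ⟨h, hh⟩ := hk
  rw [MvPolynomial.mem_ideal_span_X_image]
  intro m hm
  by_contra! hfixed
  rw [MvPolynomial.mem_support_iff, MvPolynomial.coeff_pderiv] at hm
  have hcoeff := MvPolynomial.coeff_aeval_smul_X (fun j => (χ j h : K)) f
    (m + Finsupp.single k 1)
  have hprod : (m.prod fun j n => (χ j h : K) ^ n) = 1 := by
    refine Finset.prod_eq_one fun j hj => ?_
    have hχ : χ j h = 1 := by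
      by_contra hne
      exact Finsupp.mem_support_iff.mp hj (hfixed j ⟨h, hne⟩)
    simp [hχ]
  rw [hf h, Finsupp.prod_add_index' (by simp) (by simp [pow_add]), hprod, one_mul,
    Finsupp.prod_single_index (h := fun j n => (χ j h : K) ^ n) (pow_zero _), pow_one] at hcoeff
  exact hh (Units.ext ((right_eq_mul₀ (left_ne_zero_of_mul hm)).mp hcoeff))
end

section
/- Let $K$ be a field, $H$ a group, $\sigma$ a finite index type, and $\chi_j : H \to K^{\times}$ a character for each $j \in \sigma$; call an index $j$ moving if there exists $h \in H$ with $\chi_j(h) \neq 1$. Let $f \in K[x_j : j \in \sigma]$ be $H$-invariant, i.e. $T_h(f) = f$ for all $h \in H$. Then the ideal generated by $\{\partial_k f : k \text{ not moving}\} \cup \{x_i : i \text{ moving}\}$ equals the ideal generated by $\{\partial_k f : k \in \sigma\} \cup \{x_i : i \text{ moving}\}$. (This is the algebraic expression of the statement that the critical locus of $f$ intersected with the fixed locus equals the critical locus of the restriction of $f$ to the fixed locus.) -/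
namespace MvPolynomial

/-- Rescaling the variables by `c` multiplies the coefficient at `n` by the monomial `c ^ n`. -/
theorem coeff_aeval_smul_X_s2 {R σ : Type*} [CommSemiring R] (c : σ → R)
    (f : MvPolynomial σ R) (n : σ →₀ ℕ) :
    coeff n (aeval (fun j => c j • (X j : MvPolynomial σ R)) f) =
      (n.prod fun j e => c j ^ e) * coeff n f := by
  classical
  induction f using MvPolynomial.induction_on' with
  | monomial m a =>
    have h : aeval (fun j => c j • (X j : MvPolynomial σ R)) (monomial m a) =
        monomial m ((m.prod fun j e => c j ^ e) * a) := by
      rw [aeval_monomial, algebraMap_eq, monomial_eq]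
      simp only [smul_eq_C_mul, mul_pow, Finset.prod_mul_distrib, Finsupp.prod, map_mul, map_prod,
        map_pow]
      ring
    rw [h, coeff_monomial, coeff_monomial]
    split_ifs with hmn
    · rw [hmn]
    · rw [mul_zero]
  | add p q hp hq => rw [map_add, coeff_add, coeff_add, hp, hq, mul_add]

/-- The derivative of an invariant polynomial in a moving direction lies in the ideal of the
moving variables. -/
theorem pderiv_mem_span_X_of_moving {R H σ : Type*} [CommRing R] [IsDomain R] [Group H]
    (χ : σ → H →* Rˣ) {f : MvPolynomial σ R}
    (hf : ∀ h : H, aeval (fun j => ((χ j h : R)) • (X j : MvPolynomial σ R)) f = f)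
    {k : σ} (hk : ∃ h : H, χ k h ≠ 1) :
    pderiv k f ∈ Ideal.span
      ((X : σ → MvPolynomial σ R) '' {i : σ | ∃ h : H, χ i h ≠ 1}) := by
  classical
  rw [mem_ideal_span_X_image]
  intro m hm
  by_contra! hfix
  obtain ⟨h, hh⟩ := hk
  rw [mem_support_iff, coeff_pderiv] at hm
  have hcoeff := left_ne_zero_of_mul hm
  have hweight : ((m + Finsupp.single k 1).prod fun j e => (χ j h : R) ^ e) = 1 := by
    refine mul_right_cancel₀ hcoeff ?_
    rw [← coeff_aeval_smul_X_s2, hf, one_mul]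
  have hm_weight : (m.prod fun j e => (χ j h : R) ^ e) = 1 := by
    refine Finset.prod_eq_one fun j hj => ?_
    have hj' : χ j h = 1 := by
      by_contra hne
      exact Finsupp.mem_support_iff.mp hj (hfix j ⟨h, hne⟩)
    simp [hj']
  rw [Finsupp.prod_add_index' (by simp) (by simp [pow_add]), hm_weight, one_mul,
    Finsupp.prod_single_index (by simp), pow_one] at hweight
  exact hh (Units.ext hweight)

end MvPolynomial

/-- With the diagonal action of a group `H` on `K[xⱼ : j ∈ σ]` through
characters `χ j : H →* Kˣ` (an index is *moving* if its character is nontrivial), if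
`f` is `H`-invariant then the ideal generated by the partial derivatives of `f` in the
non-moving directions together with the moving variables equals the ideal generated by
*all* partial derivatives of `f` together with the moving variables.  This is the
algebraic form of `Z(df) ∩ D^H = Z(d(f|_{D^H}))`. -/
theorem span_pderiv_nonmoving_union_moving_eq_span_pderiv_union_moving
    {K H σ : Type*} [Field K] [Group H] [Fintype σ]
    (χ : σ → H →* Kˣ) (f : MvPolynomial σ K)
    (hf : ∀ h : H,
      MvPolynomial.aeval
        (fun j => ((χ j h : K)) • (MvPolynomial.X j : MvPolynomial σ K)) f = f) :
    Ideal.span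
        (((fun j => MvPolynomial.pderiv j f) '' {j : σ | ¬ ∃ h : H, χ j h ≠ 1}) ∪
          (MvPolynomial.X '' {i : σ | ∃ h : H, χ i h ≠ 1}))
      = Ideal.span
        (((fun j => MvPolynomial.pderiv j f) '' (Set.univ : Set σ)) ∪
          (MvPolynomial.X '' {i : σ | ∃ h : H, χ i h ≠ 1})) := by
  apply le_antisymm
  · exact Ideal.span_mono (Set.union_subset_union_left _ (Set.image_mono (Set.subset_univ _)))
  · rw [Ideal.span_le, Set.union_subset_iff]
    refine ⟨?_, Set.subset_union_right.trans Ideal.subset_span⟩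
    rintro _ ⟨k, -, rfl⟩
    by_cases hk : ∃ h : H, χ k h ≠ 1
    · exact Ideal.span_mono Set.subset_union_right
        (MvPolynomial.pderiv_mem_span_X_of_moving χ hf hk)
    · exact Ideal.subset_span (Or.inl ⟨k, hk, rfl⟩)
end

section
/- Let $H$ be an abelian group acting diagonally on $\mathbb{C}^n$ via characters $\chi_j : H \to \mathbb{C}^{\times}$, i.e. $h \cdot x = (\chi_1(h)x_1, \dots, \chi_n(h)x_n)$; call an index $j$ moving if $\chi_j$ is not the trivial character. Let $D \subseteq \mathbb{C}^n$ be an open set with $h \cdot x \in D$ for all $h \in H$, $x \in D$, and let $f : \mathbb{C}^n \to \mathbb{C}$ be complex-differentiable at every point of $D$ and $H$-invariant on $D$, i.e. $f(h \cdot x) = f(x)$ for all $h \in H$, $x \in D$. Then for every point $x \in D$ lying in the fixed locus (i.e. with $x_j = 0$ for every moving index $j$), the total complex derivative $Df_x$ vanishes if and only if $Df_x(v) = 0$ for every vector $v \in \mathbb{C}^n$ with $v_j = 0$ for all moving $j$. Equivalently, $Z(df) \cap D^H = Z(d(f|_{D^H}))$: the critical points of $f$ lying on the fixed locus coincide with the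 critical points of the restriction of $f$ to the fixed locus. -/
/-- If `f` is invariant near a fixed point `x` of a continuous linear map `A`, then so is its
derivative at `x`. -/
theorem fderiv_apply_of_eventually_invariant {𝕜 E F : Type*} [NontriviallyNormedField 𝕜]
    [NormedAddCommGroup E] [NormedSpace 𝕜 E] [NormedAddCommGroup F] [NormedSpace 𝕜 F]
    {f : E → F} {x : E} (A : E →L[𝕜] E) (hf : DifferentiableAt 𝕜 f x) (hAx : A x = x)
    (hinv : ∀ᶠ y in nhds x, f (A y) = f y) (v : E) :
    fderiv 𝕜 f x (A v) = fderiv 𝕜 f x v := by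
  have hfA : HasFDerivAt f (fderiv 𝕜 f x) (A x) := hAx.symm ▸ hf.hasFDerivAt
  have hcomp : HasFDerivAt f ((fderiv 𝕜 f x).comp A) x :=
    (hfA.comp x A.hasFDerivAt).congr_of_eventuallyEq (hinv.mono fun _ hy => hy.symm)
  exact congrArg (fun L : E →L[𝕜] F => L v) (hcomp.unique hf.hasFDerivAt)

/-- Let `H` be an abelian group acting diagonally on `ℂⁿ` via
characters `χ j : H →* ℂˣ`, with *moving* indices those `j` whose character is
nontrivial.  Let `D ⊆ ℂⁿ` be an `H`-invariant open set and `f : ℂⁿ → ℂ` be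
complex-differentiable at every point of `D` and `H`-invariant on `D`.  Then for every
point `x ∈ D` lying on the fixed locus (all moving coordinates vanish), the total
derivative `Df_x` vanishes iff it vanishes on all vectors supported on the fixed locus.
Equivalently `Z(df) ∩ D^H = Z(d(f|_{D^H}))`. -/
theorem critical_on_fixed_locus_iff
    {n : ℕ} {H : Type*} [CommGroup H] (χ : Fin n → H →* ℂˣ)
    (D : Set (Fin n → ℂ)) (hD : IsOpen D)
    (hDinv : ∀ h : H, ∀ x ∈ D, (fun j => ((χ j h : ℂ)) * x j) ∈ D)
    (f : (Fin n → ℂ) → ℂ)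
    (hdiff : ∀ x ∈ D, DifferentiableAt ℂ f x)
    (hfinv : ∀ h : H, ∀ x ∈ D, f (fun j => ((χ j h : ℂ)) * x j) = f x)
    (x : Fin n → ℂ) (hx : x ∈ D)
    (hfix : ∀ j : Fin n, (∃ h : H, χ j h ≠ 1) → x j = 0) :
    fderiv ℂ f x = 0 ↔
      ∀ v : Fin n → ℂ, (∀ j : Fin n, (∃ h : H, χ j h ≠ 1) → v j = 0) →
        fderiv ℂ f x v = 0 := by
  refine ⟨fun h v _ => by simp [h], fun hv => ?_⟩
  refine ContinuousLinearMap.coe_injective ((Pi.basisFun ℂ (Fin n)).ext fun j => ?_)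
  simp only [Pi.basisFun_apply, ContinuousLinearMap.coe_coe, ContinuousLinearMap.toLinearMap_zero,
    LinearMap.zero_apply]
  by_cases hj : ∃ h : H, χ j h ≠ 1
  · obtain ⟨h, hh⟩ := hj
    let A : (Fin n → ℂ) →L[ℂ] (Fin n → ℂ) :=
      ContinuousLinearMap.pi fun i => (χ i h : ℂ) • ContinuousLinearMap.proj i
    have hAx : A x = x := by
      ext i
      by_cases hi : χ i h = 1
      · simp [A, hi]
      · simp [A, hfix i ⟨h, hi⟩]
    have hA : A (Pi.single j 1) = (χ j h : ℂ) • Pi.single j 1 := by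
      ext i
      by_cases hi : i = j
      · subst hi
        simp [A]
      · simp [A, hi]
    have key := fderiv_apply_of_eventually_invariant A (hdiff x hx) hAx
      (Filter.eventually_of_mem (hD.mem_nhds hx) (hfinv h)) (Pi.single j 1)
    rw [hA, map_smul, smul_eq_mul] at key
    by_contra hne
    exact hh (Units.ext ((mul_eq_right₀ hne).1 key))
  · refine hv _ fun i hi => Pi.single_eq_of_ne ?_ _
    rintro rfl
    exact hj hi
end

section
/- Let $k$ be a field of characteristic zero and $A$ a commutative differential graded algebra over $k$ with differential $d$. Let $W \in k$ and let $a, a' \in A^{-1}$ satisfy $d(a) = W \cdot 1_A$ and $d(a') = W \cdot 1_A$, and suppose $a' - a = d(h)$ for some nilpotent element $h \in A^{-2}$ of degree $-2$. Define $E := \exp(-h) = \sum_{n \ge 0} (-h)^n / n!$ (a finite sum by nilpotency) and the twisted operators $d_a(x) := d(x) + a\,x$ and $d_{a'}(x) := d(x) + a'\,x$. Then $E$ is a unit of $A$ and $d_{a'}(E\,x) = E\, d_a(x)$ for every $x \in A$; that is, multiplication by $\exp(-h)$ is an isomorphism from the factorization $(A, d_a)$ to the factorization $(A, d_{a'})$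 of $W$. -/
/-- A commutative differential graded algebra over a field `k` of characteristic zero:
a unital associative `k`-algebra `A` with an internal direct sum decomposition into
`k`-subspaces `grading i` (`i : ℤ`) such that `1 ∈ grading 0` and
`grading i * grading j ⊆ grading (i+j)`, graded commutativity
`x * y = (-1)^(i*j) • (y * x)` for homogeneous `x, y`, together with a `k`-linear
differential `d` of degree `+1` squaring to zero and satisfying the graded Leibniz rule
`d (x * y) = d x * y + (-1)^i • (x * d y)` for `x` of degree `i`. -/
structure CDGA (k : Type*) [Field k] [CharZero k]
    (A : Type*) [Ring A] [Algebra k A] where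
  grading : ℤ → Submodule k A
  one_mem : (1 : A) ∈ grading 0
  mul_mem : ∀ {i j : ℤ} {x y : A}, x ∈ grading i → y ∈ grading j →
    x * y ∈ grading (i + j)
  internal : DirectSum.IsInternal grading
  comm : ∀ (i j : ℤ) (x y : A), x ∈ grading i → y ∈ grading j →
    x * y = ((-1 : k) ^ (i * j)) • (y * x)
  d : A →ₗ[k] A
  d_mem : ∀ (i : ℤ) {x : A}, x ∈ grading i → d x ∈ grading (i + 1)
  d_sq : ∀ x : A, d (d x) = 0
  leibniz : ∀ (i : ℤ) (x y : A), x ∈ grading i →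
    d (x * y) = d x * y + ((-1 : k) ^ i) • (x * d y)

/-- The truncated exponential `exp(h) = ∑_{n < N} hⁿ / n!` of an element `h` with
`h ^ N = 0`; by nilpotency this is the full exponential series. -/
noncomputable def nilpotentExp (k : Type*) [Field k] {A : Type*} [Ring A]
    [Algebra k A] (h : A) (N : ℕ) : A :=
  ∑ n ∈ Finset.range N, ((n.factorial : k)⁻¹) • h ^ n

theorem isUnit_nilpotentExp {k A : Type*} [Field k] [Ring A] [Algebra k A]
    {y : A} {N : ℕ} (hy : y ^ N = 0) : IsUnit (nilpotentExp k y N) := by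
  cases N with
  | zero =>
    have : Subsingleton A := subsingleton_of_zero_eq_one (by simpa using hy.symm)
    exact isUnit_of_subsingleton _
  | succ M =>
    rw [nilpotentExp, Finset.sum_range_succ']
    simp only [Nat.factorial_zero, Nat.cast_one, inv_one, pow_zero, one_smul]
    refine IsNilpotent.isUnit_add_one (Commute.isNilpotent_sum (fun n _ ↦ ?_) fun i j _ _ ↦ ?_)
    · exact (IsNilpotent.pow_succ n ⟨M + 1, hy⟩).smul _
    · exact (((Commute.refl y).pow_pow _ _).smul_left _).smul_right _

theorem commute_nilpotentExp {k A : Type*} [Field k] [Ring A] [Algebra k A]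
    {b y : A} (hb : Commute b y) (N : ℕ) : Commute b (nilpotentExp k y N) :=
  Commute.sum_right _ _ _ fun n _ ↦ (hb.pow_right n).smul_right _

namespace CDGA

variable {k A : Type*} [Field k] [CharZero k] [Ring A] [Algebra k A] (C : CDGA k A)

theorem commute_of_mem_even {i j : ℤ} (hj : Even j) {x y : A}
    (hx : x ∈ C.grading i) (hy : y ∈ C.grading j) : Commute x y := by
  have h := C.comm i j x y hx hy
  rwa [(hj.mul_left i).neg_one_zpow, one_smul] at h

theorem d_mul_of_mem_even {i : ℤ} (hi : Even i) {y : A} (hy : y ∈ C.grading i) (x : A) :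
    C.d (y * x) = C.d y * x + y * C.d x := by
  rw [C.leibniz i y x hy, hi.neg_one_zpow, one_smul]

theorem d_pow_succ_mul {i : ℤ} (hi : Even i) {y : A} (hy : y ∈ C.grading i) (n : ℕ) (x : A) :
    C.d (y ^ (n + 1) * x) = ((n + 1 : ℕ) : k) • (y ^ n * (C.d y * x)) + y ^ (n + 1) * C.d x := by
  have hcomm (m : ℕ) : C.d y * y ^ m = y ^ m * C.d y :=
    (C.commute_of_mem_even hi (C.d_mem i hy) hy).pow_right m
  induction n with
  | zero => simp [C.d_mul_of_mem_even hi hy]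
  | succ n ih =>
    rw [pow_succ' y (n + 1), mul_assoc, C.d_mul_of_mem_even hi hy, ih, ← mul_assoc (C.d y), hcomm,
      mul_add, mul_smul_comm, ← mul_assoc y (y ^ n), ← pow_succ', ← mul_assoc y (y ^ (n + 1)),
      Nat.cast_succ (n + 1), add_smul, one_smul, mul_assoc]
    abel

theorem pow_mul_d_eq_zero {i : ℤ} (hi : Even i) {y : A} (hy : y ∈ C.grading i) {n : ℕ}
    (hn : y ^ (n + 1) = 0) (x : A) : y ^ n * (C.d y * x) = 0 := by
  have h := C.d_pow_succ_mul hi hy n x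
  rw [hn, zero_mul, zero_mul, map_zero, add_zero] at h
  exact (smul_eq_zero.mp h.symm).resolve_left (Nat.cast_ne_zero.mpr n.succ_ne_zero)

theorem d_nilpotentExp_mul {i : ℤ} (hi : Even i) {y : A} (hy : y ∈ C.grading i) {N : ℕ}
    (hN : y ^ N = 0) (x : A) :
    C.d (nilpotentExp k y N * x) = nilpotentExp k y N * (C.d y * x + C.d x) := by
  cases N with
  | zero => simp [nilpotentExp]
  | succ M =>
    have hE : nilpotentExp k y (M + 1) * (C.d y * x) =
        ∑ n ∈ Finset.range M, ((n.factorial : k)⁻¹) • (y ^ n * (C.d y * x)) := by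
      rw [nilpotentExp, Finset.sum_range_succ, add_mul, smul_mul_assoc,
        C.pow_mul_d_eq_zero hi hy hN, smul_zero, add_zero, Finset.sum_mul]
      simp only [smul_mul_assoc]
    have hfac (n : ℕ) : (((n + 1).factorial : k)⁻¹) * ((n + 1 : ℕ) : k) = (n.factorial : k)⁻¹ := by
      have h₁ : ((n + 1 : ℕ) : k) ≠ 0 := Nat.cast_ne_zero.mpr n.succ_ne_zero
      rw [Nat.factorial_succ, Nat.cast_mul, mul_inv_rev, inv_mul_cancel_right₀ h₁]
    rw [mul_add, hE, nilpotentExp, Finset.sum_range_succ', add_mul, add_mul, map_add,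
      Finset.sum_mul, Finset.sum_mul, map_sum]
    simp only [smul_mul_assoc, map_smul, C.d_pow_succ_mul hi hy, smul_add, smul_smul, hfac,
      Finset.sum_add_distrib, pow_zero, one_mul, add_assoc]

end CDGA

/-- Let `A` be a cdga over a field `k` of characteristic zero with
differential `d`.  Let `W ∈ k` and `a, a' ∈ A⁻¹` with `d a = W • 1 = d a'`, and suppose
`a' - a = d h` for a nilpotent `h ∈ A⁻²` (say `h ^ N = 0`).  Then
`E := exp(-h) = ∑_{n<N} (-h)ⁿ/n!` is a unit of `A` and `d_{a'} (E * x) = E * d_a x`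
for every `x`, where `d_a x = d x + a * x`: multiplication by `exp (-h)` is an
isomorphism of the factorizations `(A, d_a)` and `(A, d_{a'})` of `W`. -/
theorem exp_neg_h_intertwines_twisted_differentials
    {k A : Type*} [Field k] [CharZero k] [Ring A] [Algebra k A]
    (C : CDGA k A) (W : k) (a a' h : A)
    (ha : a ∈ C.grading (-1)) (ha' : a' ∈ C.grading (-1))
    (hh : h ∈ C.grading (-2))
    (hda : C.d a = W • (1 : A)) (hda' : C.d a' = W • (1 : A))
    (hdiff : a' - a = C.d h)
    (N : ℕ) (hN : h ^ N = 0) :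
    IsUnit (nilpotentExp k (-h) N) ∧
      ∀ x : A,
        C.d (nilpotentExp k (-h) N * x) + a' * (nilpotentExp k (-h) N * x)
          = nilpotentExp k (-h) N * (C.d x + a * x) := by
  have hy : -h ∈ C.grading (-2) := neg_mem hh
  have hyN : (-h) ^ N = 0 := by rw [neg_pow, hN, mul_zero]
  refine ⟨isUnit_nilpotentExp hyN, fun x ↦ ?_⟩
  have hcomm := commute_nilpotentExp (k := k) (C.commute_of_mem_even (by decide) ha' hy) N
  rw [C.d_nilpotentExp_mul (by decide) hy hyN, ← mul_assoc a', hcomm.eq, mul_assoc, ← mul_add,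
    map_neg, ← hdiff]
  congr 1
  noncomm_ring
end
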